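/- For every K > 0 there exist constants τ > 0 and C₁ > 0, depending only on n, Ω, Ω̃, h, h̃, θ, θ̃ and K, with the following property. Let f ∈ 𝒜 with ‖f‖_{C²(Ω̄ × closure(Ω̃))} ≤ K satisfy condition (OSC), and let u be a smooth uniformly convex solution of the second boundary value problem with data (f, c). Define ω : Ω̄ → ℝ by ω(x) := ⟨∇h(∇u(x)), ∇h̃(x)⟩ + τ·h(∇u(x)). Then at every point x₀ ∈ ∂Ω at which ω attains its minimum over ∂Ω, the directional derivative of ω at x₀ in the inner normal direction ν(x₀) = ∇h̃(x₀) satisfies D_{ν(x₀)}ω(x₀) ≥ −C₁. -/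

import Mathlib

open Set MeasureTheory Matrix
open scoped Topology RealInnerProductSpace NNReal

noncomputable section

abbrev Euc (n : ℕ) := EuclideanSpace ℝ (Fin n)

variable {n : ℕ}

/-- Hessian matrix of `u` at `x`. -/
def Hess (u : Euc n → ℝ) (x : Euc n) : Matrix (Fin n) (Fin n) ℝ :=
  fun i j => iteratedFDeriv ℝ 2 u x ![EuclideanSpace.single i 1, EuclideanSpace.single j 1]

/-- `A ≤ B` in the sense of symmetric matrices. -/
def MatLE (A B : Matrix (Fin n) (Fin n) ℝ) : Prop := (B - A).PosSemidef

/-- The Minkowski mean-curvature operator `div (∇u / √(1 - |∇u|²))`. -/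
def MinkDiv (u : Euc n → ℝ) (x : Euc n) : ℝ :=
  ∑ i, fderiv ℝ (fun y => (Real.sqrt (1 - ‖gradient u y‖ ^ 2))⁻¹ * gradient u y i) x
    (EuclideanSpace.single i 1)

/-- The Euclidean mean-curvature operator `div (∇u / √(1 + |∇u|²))`. -/
def EucDiv (u : Euc n → ℝ) (x : Euc n) : ℝ :=
  ∑ i, fderiv ℝ (fun y => (Real.sqrt (1 + ‖gradient u y‖ ^ 2))⁻¹ * gradient u y i) x
    (EuclideanSpace.single i 1)

/-- `S(p) = (1/v)(Iₙ + p pᵀ / v²)`, `v = √(1-|p|²)`. -/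
def Smat (p : Euc n) : Matrix (Fin n) (Fin n) ℝ :=
  (Real.sqrt (1 - ‖p‖ ^ 2))⁻¹ •
    ((1 : Matrix (Fin n) (Fin n) ℝ) +
      (1 - ‖p‖ ^ 2)⁻¹ • Matrix.vecMulVec (fun i => p i) (fun j => p j))

/-- `B(p) = Iₙ + p pᵀ / (v (1 + v))`, `v = √(1-|p|²)`. -/
def Bmat (p : Euc n) : Matrix (Fin n) (Fin n) ℝ :=
  (1 : Matrix (Fin n) (Fin n) ℝ) +
    (Real.sqrt (1 - ‖p‖ ^ 2) * (1 + Real.sqrt (1 - ‖p‖ ^ 2)))⁻¹ •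
      Matrix.vecMulVec (fun i => p i) (fun j => p j)

/-- `A(x) = (1/v)·B(∇u)·D²u·B(∇u)`: its eigenvalues are the principal curvatures. -/
def Amat (u : Euc n → ℝ) (x : Euc n) : Matrix (Fin n) (Fin n) ℝ :=
  (Real.sqrt (1 - ‖gradient u x‖ ^ 2))⁻¹ •
    (Bmat (gradient u x) * Hess u x * Bmat (gradient u x))

/-- supremum of the quadratic form of `A` over the unit sphere (the operator
norm / largest eigenvalue for a positive semidefinite symmetric `A`). -/
def quadSup (A : Matrix (Fin n) (Fin n) ℝ) : ℝ :=
  ⨆ ξ : Metric.sphere (0 : Euc n) 1,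
    (fun i => (ξ : Euc n) i) ⬝ᵥ A.mulVec (fun i => (ξ : Euc n) i)

/-- The domains `Ω = {h̃ > 0}`, `Ω̃ = {h > 0}` are bounded uniformly convex domains
with smooth boundary, described by the defining functions `h̃` and `h`. -/
def DomainSetup (Ω Ωt : Set (Euc n)) (ht h : Euc n → ℝ) (θt θ : ℝ) : Prop :=
  IsOpen Ω ∧ IsOpen Ωt ∧ Bornology.IsBounded Ω ∧ Bornology.IsBounded Ωt ∧
  Ω.Nonempty ∧ Ωt.Nonempty ∧
  ContDiff ℝ (⊤ : ℕ∞) ht ∧ ContDiff ℝ (⊤ : ℕ∞) h ∧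
  Ω = {x | 0 < ht x} ∧ Ωt = {y | 0 < h y} ∧
  (∀ x ∈ frontier Ω, ‖gradient ht x‖ = 1) ∧
  (∀ y ∈ frontier Ωt, ‖gradient h y‖ = 1) ∧
  0 < θt ∧ 0 < θ ∧
  (∀ x : Euc n, MatLE (Hess ht x) ((-θt) • (1 : Matrix (Fin n) (Fin n) ℝ))) ∧
  (∀ y : Euc n, MatLE (Hess h y) ((-θ) • (1 : Matrix (Fin n) (Fin n) ℝ)))

/-- `f ∈ 𝒜`: `f` is `C²` on `Ω̄ × closure Ω̃` and concave in `x`. -/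
def InA (Ω Ωt : Set (Euc n)) (f : Euc n × Euc n → ℝ) : Prop :=
  ContDiffOn ℝ 2 f (closure Ω ×ˢ closure Ωt) ∧
  ∀ p ∈ closure Ωt, ConcaveOn ℝ (closure Ω) (fun x => f (x, p))

/-- Condition (OSC): `osc f ≤ (n/2)(|Ω̃|/|Ω|)^{1/n}`. -/
def OSCcond (Ω Ωt : Set (Euc n)) (f : Euc n × Euc n → ℝ) : Prop :=
  ∀ x ∈ closure Ω, ∀ y ∈ closure Ω, ∀ p ∈ closure Ωt, ∀ q ∈ closure Ωt,
    |f (x, p) - f (y, q)| ≤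
      ((n : ℝ) / 2) * ((volume Ωt).toReal / (volume Ω).toReal) ^ ((1 : ℝ) / n)

/-- `‖f‖_{C²(Ω̄ × closure Ω̃)} ≤ K`. -/
def C2Bound (Ω Ωt : Set (Euc n)) (f : Euc n × Euc n → ℝ) (K : ℝ) : Prop :=
  ContDiffOn ℝ 2 f (closure Ω ×ˢ closure Ωt) ∧
  ∀ z ∈ closure Ω ×ˢ closure Ωt,
    |f z| ≤ K ∧ ‖fderiv ℝ f z‖ ≤ K ∧ ‖iteratedFDeriv ℝ 2 f z‖ ≤ K

/-- `sup |D_x f| ≤ ε` on `Ω̄ × closure Ω̃`. -/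
def DxBound (Ω Ωt : Set (Euc n)) (f : Euc n × Euc n → ℝ) (ε : ℝ) : Prop :=
  ∀ x ∈ closure Ω, ∀ p ∈ closure Ωt, ‖fderiv ℝ (fun x' => f (x', p)) x‖ ≤ ε

/-- `sup |D_{xp} f| ≤ ε` on `Ω̄ × closure Ω̃`. -/
def DxpBound (Ω Ωt : Set (Euc n)) (f : Euc n × Euc n → ℝ) (ε : ℝ) : Prop :=
  ∀ x ∈ closure Ω, ∀ p ∈ closure Ωt,
    ‖fderiv ℝ (fun p' => fderiv ℝ (fun x' => f (x', p')) x) p‖ ≤ ε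

/-- A strictly convex solution of the second boundary value problem. -/
def IsStrictSol (Ω Ωt : Set (Euc n)) (f : Euc n × Euc n → ℝ) (c : ℝ) (u : Euc n → ℝ) : Prop :=
  ContDiffOn ℝ 2 u (closure Ω) ∧
  (∀ x ∈ closure Ω, (Hess u x).PosDef) ∧
  (∀ x ∈ closure Ω, ‖gradient u x‖ < 1) ∧
  (∀ x ∈ Ω, MinkDiv u x = f (x, gradient u x) + c) ∧
  gradient u '' Ω = Ωt

/-- A smooth uniformly convex solution of the second boundary value problem. -/
def IsSmoothSol (Ω Ωt : Set (Euc n)) (f : Euc n × Euc n → ℝ) (c : ℝ) (u : Euc n → ℝ) : Prop :=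
  ContDiffOn ℝ (⊤ : ℕ∞) u (closure Ω) ∧
  (∃ δ : ℝ, 0 < δ ∧ ∀ x ∈ closure Ω, MatLE (δ • (1 : Matrix (Fin n) (Fin n) ℝ)) (Hess u x)) ∧
  (∀ x ∈ closure Ω, ‖gradient u x‖ < 1) ∧
  (∀ x ∈ Ω, MinkDiv u x = f (x, gradient u x) + c) ∧
  gradient u '' Ω = Ωt

/-- A uniformly convex `C^{2}` solution of the second boundary value problem. -/
def IsUCSol (Ω Ωt : Set (Euc n)) (f : Euc n × Euc n → ℝ) (c : ℝ) (u : Euc n → ℝ) : Prop :=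
  ContDiffOn ℝ 2 u (closure Ω) ∧
  (∃ δ : ℝ, 0 < δ ∧ ∀ x ∈ closure Ω, MatLE (δ • (1 : Matrix (Fin n) (Fin n) ℝ)) (Hess u x)) ∧
  (∀ x ∈ closure Ω, ‖gradient u x‖ < 1) ∧
  (∀ x ∈ Ω, MinkDiv u x = f (x, gradient u x) + c) ∧
  gradient u '' Ω = Ωt

/-- A uniformly convex `C^{4,α}` solution of the second boundary value problem
for the Minkowski mean-curvature operator. -/
def IsC4Sol (Ω Ωt : Set (Euc n)) (f : Euc n × Euc n → ℝ) (c : ℝ) (u : Euc n → ℝ)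
    (α : ℝ) : Prop :=
  ContDiffOn ℝ 4 u (closure Ω) ∧
  (∃ C : ℝ≥0, HolderOnWith C (Real.toNNReal α) (fun x => iteratedFDeriv ℝ 4 u x) (closure Ω)) ∧
  (∃ δ : ℝ, 0 < δ ∧ ∀ x ∈ closure Ω, MatLE (δ • (1 : Matrix (Fin n) (Fin n) ℝ)) (Hess u x)) ∧
  (∀ x ∈ closure Ω, ‖gradient u x‖ < 1) ∧
  (∀ x ∈ Ω, MinkDiv u x = f (x, gradient u x) + c) ∧
  gradient u '' Ω = Ωt

/-- A uniformly convex `C^{4,α}` solution of the second boundary value problem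
for the Euclidean mean-curvature operator. -/
def IsC4SolE (Ω Ωt : Set (Euc n)) (f : Euc n × Euc n → ℝ) (c : ℝ) (u : Euc n → ℝ)
    (α : ℝ) : Prop :=
  ContDiffOn ℝ 4 u (closure Ω) ∧
  (∃ C : ℝ≥0, HolderOnWith C (Real.toNNReal α) (fun x => iteratedFDeriv ℝ 4 u x) (closure Ω)) ∧
  (∃ δ : ℝ, 0 < δ ∧ ∀ x ∈ closure Ω, MatLE (δ • (1 : Matrix (Fin n) (Fin n) ℝ)) (Hess u x)) ∧
  (∀ x ∈ Ω, EucDiv u x = f (x, gradient u x) + c) ∧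
  gradient u '' Ω = Ωt

/-- `ũ` is the Legendre transform of `u`. -/
def IsLegendre (Ω Ωt : Set (Euc n)) (u ut : Euc n → ℝ) : Prop :=
  ContDiffOn ℝ (⊤ : ℕ∞) ut (closure Ωt) ∧
  (∀ x ∈ closure Ω, ut (gradient u x) = ⟪x, gradient u x⟫ - u x) ∧
  (∀ x ∈ closure Ω, gradient ut (gradient u x) = x) ∧
  (∀ x ∈ closure Ω, Hess ut (gradient u x) = (Hess u x)⁻¹)


/-- The Riesz representative of a functional, written in the standard basis. -/
def dualToEuc (n : ℕ) : (Euc n →L[ℝ] ℝ) →L[ℝ] Euc n :=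
  ∑ i, (ContinuousLinearMap.apply ℝ ℝ (EuclideanSpace.single i (1 : ℝ) : Euc n)).smulRight
    (EuclideanSpace.single i (1 : ℝ) : Euc n)

theorem sum_coord_smul_single (v : Euc n) :
    ∑ i, v i • (EuclideanSpace.single i (1 : ℝ) : Euc n) = v := by
  ext j
  simp [Finset.sum_apply, Pi.single_apply]

theorem gradient_inner_right (u : Euc n → ℝ) (x v : Euc n) :
    ⟪gradient u x, v⟫ = fderiv ℝ u x v := by
  simp [gradient]

theorem dualToEuc_inner (φ : Euc n →L[ℝ] ℝ) (v : Euc n) : ⟪dualToEuc n φ, v⟫ = φ v := by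
  conv_rhs => rw [← sum_coord_smul_single v]
  simp [dualToEuc, sum_inner, real_inner_smul_left, EuclideanSpace.inner_single_left, mul_comm]

theorem gradient_eq_dualToEuc (u : Euc n → ℝ) :
    gradient u = fun x => dualToEuc n (fderiv ℝ u x) := by
  funext x
  refine ext_inner_right ℝ fun v => ?_
  rw [gradient_inner_right, dualToEuc_inner]

theorem norm_gradient_eq (u : Euc n → ℝ) (x : Euc n) : ‖gradient u x‖ = ‖fderiv ℝ u x‖ := by
  simp [gradient]

theorem gradient_apply (u : Euc n → ℝ) (x : Euc n) (i : Fin n) :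
    gradient u x i = fderiv ℝ u x (EuclideanSpace.single i 1) := by
  rw [← gradient_inner_right, EuclideanSpace.inner_single_right]
  simp

theorem hasFDerivAt_gradient {u : Euc n → ℝ} {x : Euc n}
    (hu : DifferentiableAt ℝ (fderiv ℝ u) x) :
    HasFDerivAt (gradient u) (dualToEuc n ∘L fderiv ℝ (fderiv ℝ u) x) x := by
  rw [gradient_eq_dualToEuc]
  exact (dualToEuc n).hasFDerivAt.comp x hu.hasFDerivAt

theorem bilin_eq_sum (B : Euc n →L[ℝ] Euc n →L[ℝ] ℝ) (v w : Euc n) :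
    B v w = ∑ i, ∑ j, v i * w j *
      B (EuclideanSpace.single i 1) (EuclideanSpace.single j 1) := by
  conv_lhs => rw [← sum_coord_smul_single v, ← sum_coord_smul_single w]
  simp only [map_sum, map_smul, _root_.sum_apply, _root_.smul_apply,
    smul_eq_mul, Finset.mul_sum]
  refine Finset.sum_comm.trans ?_
  exact Finset.sum_congr rfl fun i _ => Finset.sum_congr rfl fun j _ => by ring

theorem abs_coord_le (v : Euc n) (i : Fin n) : |v i| ≤ ‖v‖ := by
  simpa using PiLp.norm_apply_le v i

theorem Hess_apply (u : Euc n → ℝ) (x : Euc n) (i j : Fin n) :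
    Hess u x i j = fderiv ℝ (fderiv ℝ u) x (EuclideanSpace.single i 1)
      (EuclideanSpace.single j 1) := by
  simp [Hess, iteratedFDeriv_two_apply]

theorem MatLE.hess_quadratic_ge {u : Euc n → ℝ} {x : Euc n} {δ : ℝ}
    (H : MatLE (δ • (1 : Matrix (Fin n) (Fin n) ℝ)) (Hess u x)) (v : Euc n) :
    δ * ‖v‖ ^ 2 ≤ fderiv ℝ (fderiv ℝ u) x v v := by
  have h := H.dotProduct_mulVec_nonneg (fun i => v i)
  have e : fderiv ℝ (fderiv ℝ u) x v v = (fun i => v i) ⬝ᵥ Hess u x *ᵥ (fun i => v i) := by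
    rw [bilin_eq_sum]
    simp only [dotProduct, mulVec, Hess_apply, Finset.mul_sum]
    exact Finset.sum_congr rfl fun i _ => Finset.sum_congr rfl fun j _ => by ring
  have e2 : δ * ‖v‖ ^ 2 = (fun i => v i) ⬝ᵥ (δ • (1 : Matrix (Fin n) (Fin n) ℝ)) *ᵥ
      (fun i => v i) := by
    rw [EuclideanSpace.norm_sq_eq, smul_mulVec, one_mulVec, dotProduct_smul, smul_eq_mul]
    simp [dotProduct, pow_two]
  rw [star_trivial, sub_mulVec, dotProduct_sub] at h
  linarith

theorem MatLE.hess_symm {u : Euc n → ℝ} {x : Euc n} {δ : ℝ}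
    (H : MatLE (δ • (1 : Matrix (Fin n) (Fin n) ℝ)) (Hess u x)) (i j : Fin n) :
    fderiv ℝ (fderiv ℝ u) x (EuclideanSpace.single i 1) (EuclideanSpace.single j 1) =
      fderiv ℝ (fderiv ℝ u) x (EuclideanSpace.single j 1) (EuclideanSpace.single i 1) := by
  have h := H.isHermitian.apply i j
  rcases eq_or_ne i j with rfl | hij
  · rfl
  · simpa [Hess_apply, Matrix.one_apply, hij, hij.symm] using h.symm

/-- The trace of a positive semidefinite form controls all its values. -/
theorem bilin_le_of_trace_le (B : Euc n →L[ℝ] Euc n →L[ℝ] ℝ) {t : ℝ}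
    (hpos : ∀ v, 0 ≤ B v v)
    (hsymm : ∀ i j, B (EuclideanSpace.single i 1) (EuclideanSpace.single j 1) =
      B (EuclideanSpace.single j 1) (EuclideanSpace.single i 1))
    (htr : ∑ i, B (EuclideanSpace.single i 1) (EuclideanSpace.single i 1) ≤ t)
    (v w : Euc n) : |B v w| ≤ (n : ℝ) ^ 2 * t * (‖v‖ * ‖w‖) := by
  have hdiag : ∀ i, B (EuclideanSpace.single i 1) (EuclideanSpace.single i 1) ≤ t := fun i =>
    (Finset.single_le_sum (fun j _ => hpos (EuclideanSpace.single j 1))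
      (Finset.mem_univ i)).trans htr
  have hent : ∀ i j, |B (EuclideanSpace.single i 1) (EuclideanSpace.single j 1)| ≤ t := by
    intro i j
    have h1 := hpos (EuclideanSpace.single i 1 + EuclideanSpace.single j 1)
    have h2 := hpos (EuclideanSpace.single i 1 - EuclideanSpace.single j 1)
    simp only [map_add, map_sub, _root_.add_apply,
      _root_.sub_apply] at h1 h2
    have := hdiag i
    have := hdiag j
    have := hsymm i j
    rw [abs_le]
    constructor <;> linarith
  rw [bilin_eq_sum]
  calc _ ≤ ∑ i, ∑ j, |v i * w j *
        B (EuclideanSpace.single i 1) (EuclideanSpace.single j 1)| :=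
        (Finset.abs_sum_le_sum_abs _ _).trans
          (Finset.sum_le_sum fun i _ => Finset.abs_sum_le_sum_abs _ _)
    _ ≤ ∑ _i : Fin n, ∑ _j : Fin n, ‖v‖ * ‖w‖ * t := by
        refine Finset.sum_le_sum fun i _ => Finset.sum_le_sum fun j _ => ?_
        rw [abs_mul, abs_mul]
        gcongr
        exacts [abs_coord_le v i, abs_coord_le w j, hent i j]
    _ = _ := by simp; ring

theorem MinkDiv_eq {u : Euc n → ℝ} {x : Euc n}
    (hu : DifferentiableAt ℝ (fderiv ℝ u) x) (hlt : ‖gradient u x‖ < 1) :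
    MinkDiv u x = (Real.sqrt (1 - ‖gradient u x‖ ^ 2))⁻¹ *
        (∑ i, fderiv ℝ (fderiv ℝ u) x (EuclideanSpace.single i 1) (EuclideanSpace.single i 1)) +
      (Real.sqrt (1 - ‖gradient u x‖ ^ 2))⁻¹ ^ 3 *
        fderiv ℝ (fderiv ℝ u) x (gradient u x) (gradient u x) := by
  set p := gradient u x with hp
  set B := fderiv ℝ (fderiv ℝ u) x with hB
  set V := Real.sqrt (1 - ‖p‖ ^ 2) with hV
  have hs : 0 < 1 - ‖p‖ ^ 2 := by nlinarith [norm_nonneg p]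
  have hVpos : 0 < V := Real.sqrt_pos.2 hs
  have hg := hasFDerivAt_gradient hu
  have hterm : ∀ i : Fin n,
      fderiv ℝ (fun y => (Real.sqrt (1 - ‖gradient u y‖ ^ 2))⁻¹ * gradient u y i) x
        (EuclideanSpace.single i 1) =
      V⁻¹ * B (EuclideanSpace.single i 1) (EuclideanSpace.single i 1) +
        V⁻¹ ^ 3 * (p i * B (EuclideanSpace.single i 1) p) := by
    intro i
    have h1 := (hasDerivAt_inv hVpos.ne').comp_hasFDerivAt x
      ((hg.norm_sq.const_sub 1).sqrt hs.ne')
    have h2 : HasFDerivAt (fun y => gradient u y i)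
        (ContinuousLinearMap.apply ℝ ℝ (EuclideanSpace.single i (1 : ℝ) : Euc n) ∘L B) x := by
      simp only [gradient_apply]
      exact (ContinuousLinearMap.apply ℝ ℝ
        (EuclideanSpace.single i (1 : ℝ) : Euc n)).hasFDerivAt.comp x hu.hasFDerivAt
    refine (DFunLike.congr_fun (h1.mul h2).fderiv (EuclideanSpace.single i 1)).trans ?_
    have hdual : ∀ φ : Euc n →L[ℝ] ℝ, ⟪p, dualToEuc n φ⟫ = φ p := fun φ => by
      rw [real_inner_comm, dualToEuc_inner]
    simp [← hp, ← hB, ← hV, hdual]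
    field_simp
  rw [MinkDiv, Finset.sum_congr rfl fun i _ => hterm i, Finset.sum_add_distrib,
    ← Finset.mul_sum, ← Finset.mul_sum]
  congr 2
  conv_rhs => enter [1]; rw [← sum_coord_smul_single p]
  simp

/-- Second-order necessary condition at a local maximum of a function minus a paraboloid. -/
theorem second_deriv_le_of_isLocalMax {u : Euc n → ℝ} {x z : Euc n} {m : ℝ}
    (hu : ContDiffAt ℝ 2 u x)
    (hmax : IsLocalMax (fun y => u y - m * ‖y - z‖ ^ 2) x) (e : Euc n) :
    fderiv ℝ (fderiv ℝ u) x e e ≤ 2 * m * ‖e‖ ^ 2 := by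
  by_contra! hlt
  set φ : ℝ → ℝ := fun t => u (x + t • e) - m * ‖x + t • e - z‖ ^ 2 with hφ
  have hline : ∀ t : ℝ, HasDerivAt (fun t : ℝ => x + t • e) e t := fun t => by
    simpa using ((hasDerivAt_id t).smul_const e).const_add x
  have hcont : Filter.Tendsto (fun t : ℝ => x + t • e) (𝓝 0) (𝓝 x) := by
    simpa using (hline 0).continuousAt.tendsto
  have hd : ∀ᶠ t in 𝓝 (0 : ℝ), HasDerivAt φ
      (fderiv ℝ u (x + t • e) e - m * (2 * ⟪x + t • e - z, e⟫)) t := by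
    have : ∀ᶠ y in 𝓝 x, DifferentiableAt ℝ u y :=
      (hu.eventually (by simp)).mono fun y hy => hy.differentiableAt (by simp)
    filter_upwards [hcont.eventually this] with t ht
    exact (ht.hasFDerivAt.comp_hasDerivAt t (hline t)).sub
      ((((hline t).sub_const z).norm_sq).const_mul m)
  have hdd : HasDerivAt (deriv φ)
      (fderiv ℝ (fderiv ℝ u) x e e - m * (2 * ‖e‖ ^ 2)) 0 := by
    have h2 : DifferentiableAt ℝ (fderiv ℝ u) x :=
      (hu.fderiv_right (m := 1) (by norm_num)).differentiableAt (by simp)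
    have h3 : HasDerivAt (fun t : ℝ => fderiv ℝ u (x + t • e)) (fderiv ℝ (fderiv ℝ u) x e) 0 := by
      refine HasFDerivAt.comp_hasDerivAt (0 : ℝ) ?_ (hline 0)
      simpa using h2.hasFDerivAt
    have h4 : HasDerivAt (fun t : ℝ => ⟪x + t • e - z, e⟫) (‖e‖ ^ 2) 0 := by
      simpa using ((hline 0).sub_const z).inner ℝ (hasDerivAt_const (0 : ℝ) e)
    have h5 := (h3.clm_apply (hasDerivAt_const (0 : ℝ) e)).sub ((h4.const_mul 2).const_mul m)
    refine HasDerivAt.congr_of_eventuallyEq (by simpa using h5) ?_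
    filter_upwards [hd] with t ht using ht.deriv
  have hmax0 : IsLocalMax φ 0 := by
    have : ∀ᶠ t in 𝓝 (0 : ℝ), _ := hcont.eventually hmax
    filter_upwards [this] with t ht
    simpa [hφ] using ht
  have hmin0 : IsLocalMin φ 0 := by
    refine isLocalMin_of_deriv_deriv_pos ?_ hmax0.deriv_eq_zero hd.self_of_nhds.continuousAt
    rw [hdd.deriv]
    linarith
  have hconst : φ =ᶠ[𝓝 0] fun _ => φ 0 := by
    filter_upwards [hmax0, hmin0] with t h1 h2 using le_antisymm h1 h2
  have h0 := hconst.deriv.deriv_eq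
  rw [hdd.deriv] at h0
  simp at h0
  linarith

/-- A function with gradient bounded by one on a ball of radius `r` has, at some point of the ball,
second derivatives bounded above by `4 / r`. -/
theorem exists_second_deriv_le {u : Euc n → ℝ} {Ω : Set (Euc n)} {z : Euc n} {r : ℝ}
    (hr : 0 < r) (hΩ : IsOpen Ω) (hball : Metric.closedBall z r ⊆ Ω)
    (hu : ContDiffOn ℝ 2 u Ω) (hgrad : ∀ x ∈ Ω, ‖gradient u x‖ < 1) :
    ∃ x ∈ Ω, ∀ e, fderiv ℝ (fderiv ℝ u) x e e ≤ 4 / r * ‖e‖ ^ 2 := by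
  have hzmem : z ∈ Metric.closedBall z r := Metric.mem_closedBall_self hr.le
  obtain ⟨x, hx, hmax⟩ := (isCompact_closedBall z r).exists_isMaxOn
    (f := fun y => u y - 2 / r * ‖y - z‖ ^ 2) ⟨z, hzmem⟩
    ((hu.continuousOn.mono hball).sub (by fun_prop))
  have hdiff : ∀ y ∈ Metric.closedBall z r, DifferentiableAt ℝ u y := fun y hy =>
    (hu.contDiffAt (hΩ.mem_nhds (hball hy))).differentiableAt (by simp)
  have hlip : ‖u x - u z‖ ≤ 1 * ‖x - z‖ :=
    (convex_closedBall z r).norm_image_sub_le_of_norm_fderiv_le hdiff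
      (fun y hy => by rw [← norm_gradient_eq]; exact (hgrad y (hball hy)).le) hzmem hx
  have hxlt : ‖x - z‖ < r := by
    have hle : ‖x - z‖ ≤ r := by simpa [dist_eq_norm] using hx
    refine lt_of_le_of_ne hle fun heq => ?_
    have h1 : u z - 2 / r * ‖z - z‖ ^ 2 ≤ u x - 2 / r * ‖x - z‖ ^ 2 := hmax hzmem
    have h2 : 2 / r * r ^ 2 = 2 * r := by field_simp
    have h3 := (le_abs_self _).trans hlip
    rw [heq] at h1 h3
    simp only [sub_self, norm_zero] at h1
    norm_num at h1
    linarith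
  have hloc : IsLocalMax (fun y => u y - 2 / r * ‖y - z‖ ^ 2) x :=
    hmax.isLocalMax (Filter.mem_of_superset
      (Metric.isOpen_ball.mem_nhds (by simpa [dist_eq_norm] using hxlt))
      Metric.ball_subset_closedBall)
  refine ⟨x, hball hx, fun e => ?_⟩
  have := second_deriv_le_of_isLocalMax (hu.contDiffAt (hΩ.mem_nhds (hball hx))) hloc e
  calc _ ≤ _ := this
    _ = _ := by ring

/-- A bound for the directional derivative of the gradient in the interior persists at a boundary
point from which the direction points inward. -/
theorem norm_fderiv_le_of_inward {g : Euc n → Euc n} {Ω : Set (Euc n)} {x ν : Euc n} {C : ℝ}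
    (hg : DifferentiableAt ℝ g x) (hdiff : ∀ y ∈ Ω, DifferentiableAt ℝ g y)
    (hbound : ∀ y ∈ Ω, ‖fderiv ℝ g y ν‖ ≤ C)
    (hin : ∀ᶠ t in 𝓝[>] (0 : ℝ), x + t • ν ∈ Ω) : ‖fderiv ℝ g x ν‖ ≤ C := by
  have hline : ∀ t : ℝ, HasDerivAt (fun t : ℝ => x + t • ν) ν t := fun t => by
    simpa using ((hasDerivAt_id t).smul_const ν).const_add x
  obtain ⟨ε, hε, hsub⟩ := mem_nhdsGT_iff_exists_Ioo_subset.1 hin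
  have hderiv : ∀ t ∈ Ioo 0 ε, HasDerivAt (fun t : ℝ => g (x + t • ν))
      (fderiv ℝ g (x + t • ν) ν) t := fun t ht =>
    (hdiff _ (hsub ht)).hasFDerivAt.comp_hasDerivAt t (hline t)
  have h0 : HasDerivAt (fun t : ℝ => g (x + t • ν)) (fderiv ℝ g x ν) 0 := by
    refine HasFDerivAt.comp_hasDerivAt (0 : ℝ) ?_ (hline 0)
    simpa using hg.hasFDerivAt
  have hcont0 : Filter.Tendsto (fun s : ℝ => g (x + s • ν)) (𝓝[>] 0) (𝓝 (g x)) := by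
    have := h0.continuousAt.tendsto.mono_left (nhdsWithin_le_nhds (s := Ioi 0))
    simpa using this
  have hslope : ∀ t ∈ Ioo 0 ε, ‖g (x + t • ν) - g x‖ ≤ C * t := by
    intro t ht
    have hle : ∀ᶠ s in 𝓝[>] (0 : ℝ), ‖g (x + t • ν) - g (x + s • ν)‖ ≤ C * ‖t - s‖ := by
      filter_upwards [Ioo_mem_nhdsGT ht.1] with s hs
      exact (convex_Ioo 0 ε).norm_image_sub_le_of_norm_hasDerivWithin_le
        (fun y hy => (hderiv y hy).hasDerivWithinAt) (fun y hy => hbound _ (hsub hy))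
        ⟨hs.1, hs.2.trans ht.2⟩ ht
    have hlim : Filter.Tendsto (fun s : ℝ => C * ‖t - s‖) (𝓝[>] 0) (𝓝 (C * ‖t - 0‖)) :=
      ((by fun_prop : Continuous fun s : ℝ => C * ‖t - s‖).tendsto 0).mono_left
        nhdsWithin_le_nhds
    have := le_of_tendsto_of_tendsto (tendsto_const_nhds.sub hcont0).norm hlim hle
    simpa [abs_of_pos ht.1] using this
  have hlim := (hasDerivAt_iff_tendsto_slope_zero.1 h0).mono_left
    (nhdsWithin_mono (0 : ℝ) (fun t (ht : 0 < t) => ht.ne') : 𝓝[>] (0 : ℝ) ≤ _)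
  refine le_of_tendsto hlim.norm ?_
  filter_upwards [Ioo_mem_nhdsGT hε] with t ht
  have := hslope t ht
  rw [norm_smul, norm_inv, Real.norm_of_nonneg ht.1.le, inv_mul_le_iff₀ ht.1]
  simpa [mul_comm] using this

theorem eq_zero_of_mem_frontier_pos {φ : Euc n → ℝ} (hφ : Continuous φ) {x : Euc n}
    (hx : x ∈ frontier {y | 0 < φ y}) : φ x = 0 :=
  (frontier_lt_subset_eq continuous_const hφ hx).symm

/-- The gradient of a defining function points inward. -/
theorem eventually_inward {φ : Euc n → ℝ} {x : Euc n} (hφ : DifferentiableAt ℝ φ x)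
    (h0 : φ x = 0) (h1 : ‖gradient φ x‖ = 1) :
    ∀ᶠ t in 𝓝[>] (0 : ℝ), 0 < φ (x + t • gradient φ x) := by
  have hd : HasDerivAt (fun t : ℝ => φ (x + t • gradient φ x)) 1 0 := by
    have hline : HasDerivAt (fun t : ℝ => x + t • gradient φ x) (gradient φ x) 0 := by
      simpa using ((hasDerivAt_id (0 : ℝ)).smul_const (gradient φ x)).const_add x
    have h2 : HasFDerivAt φ (fderiv ℝ φ x) (x + (0 : ℝ) • gradient φ x) := by
      simpa using hφ.hasFDerivAt
    have h3 := h2.comp_hasDerivAt (0 : ℝ) hline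
    rwa [← gradient_inner_right, real_inner_self_eq_norm_sq, h1, one_pow] at h3
  have hlim := (hasDerivAt_iff_tendsto_slope_zero.1 hd).mono_left
    (nhdsWithin_mono (0 : ℝ) (fun t (ht : 0 < t) => ht.ne') : 𝓝[>] (0 : ℝ) ≤ _)
  filter_upwards [hlim.eventually (lt_mem_nhds one_pos), self_mem_nhdsWithin] with t ht htpos
  have htpos : 0 < t := htpos
  simp only [zero_add, zero_smul, add_zero, h0, sub_zero, smul_eq_mul] at ht
  exact pos_of_mul_pos_right ht (inv_nonneg.2 htpos.le)

theorem contDiff_gradient {φ : Euc n → ℝ} (hφ : ContDiff ℝ 2 φ) : ContDiff ℝ 1 (gradient φ) := by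
  rw [gradient_eq_dualToEuc]
  exact (dualToEuc n).contDiff.comp (hφ.fderiv_right (by norm_num))

theorem differentiableAt_fderiv_of_hess {u : Euc n → ℝ} {x : Euc n} {δ : ℝ} (hn : 0 < n)
    (hδ : 0 < δ) (H : MatLE (δ • (1 : Matrix (Fin n) (Fin n) ℝ)) (Hess u x)) :
    DifferentiableAt ℝ (fderiv ℝ u) x := by
  by_contra hnd
  have := H.hess_quadratic_ge (EuclideanSpace.single ⟨0, hn⟩ 1)
  rw [fderiv_zero_of_not_differentiableAt hnd] at this
  simp at this
  linarith

/-- Interior Hessian bound: a convex solution has Hessian trace at most its Minkowski mean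
curvature, and the constant `c` is controlled at a point where the Hessian is not too large. -/
theorem IsSmoothSol.hess_le {Ω Ωt : Set (Euc n)} {f : Euc n × Euc n → ℝ} {c K V r : ℝ}
    {u : Euc n → ℝ} {z : Euc n} (hn : 0 < n) (hΩ : IsOpen Ω) (hr : 0 < r)
    (hball : Metric.closedBall z r ⊆ Ω)
    (hV : ∀ p ∈ closure Ωt, (Real.sqrt (1 - ‖p‖ ^ 2))⁻¹ ≤ V) (hf : C2Bound Ω Ωt f K)
    (hu : IsSmoothSol Ω Ωt f c u) {x : Euc n} (hx : x ∈ Ω) (v w : Euc n) :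
    |fderiv ℝ (fderiv ℝ u) x v w| ≤
      (n : ℝ) ^ 2 * (V * (n * (4 / r)) + V ^ 3 * (4 / r) + 2 * K) * (‖v‖ * ‖w‖) := by
  obtain ⟨hsm, ⟨δ, hδ, hH⟩, hgrad, heq, himg⟩ := hu
  have hsub : Ω ⊆ closure Ω := subset_closure
  have hmem : ∀ y ∈ Ω, gradient u y ∈ closure Ωt := fun y hy =>
    subset_closure (himg ▸ mem_image_of_mem _ hy)
  have hdd : ∀ y ∈ Ω, DifferentiableAt ℝ (fderiv ℝ u) y := fun y hy =>
    differentiableAt_fderiv_of_hess hn hδ (hH y (hsub hy))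
  have hpos : ∀ y ∈ Ω, ∀ e, 0 ≤ fderiv ℝ (fderiv ℝ u) y e e := fun y hy e =>
    (by positivity : 0 ≤ δ * ‖e‖ ^ 2).trans ((hH y (hsub hy)).hess_quadratic_ge e)
  have hfb : ∀ y ∈ Ω, |f (y, gradient u y)| ≤ K := fun y hy =>
    (hf.2 (y, gradient u y) ⟨hsub hy, hmem y hy⟩).1
  have hVge : ∀ y ∈ Ω, 1 ≤ (Real.sqrt (1 - ‖gradient u y‖ ^ 2))⁻¹ := fun y hy => by
    have hlt := hgrad y (hsub hy)
    refine (one_le_inv₀ (Real.sqrt_pos.2 (by nlinarith [norm_nonneg (gradient u y)]))).2 ?_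
    exact Real.sqrt_le_iff.2 ⟨zero_le_one, by linarith [sq_nonneg ‖gradient u y‖]⟩
  obtain ⟨y, hy, hyle⟩ := exists_second_deriv_le hr hΩ hball
    ((hsm.mono hsub).of_le (WithTop.coe_le_coe.2 (le_top : (2 : ℕ∞) ≤ ⊤))) fun y hy => hgrad y (hsub hy)
  have hc : c ≤ V * (n * (4 / r)) + V ^ 3 * (4 / r) + K := by
    have h1 := heq y hy
    rw [MinkDiv_eq (hdd y hy) (hgrad y (hsub hy))] at h1
    have h2 : ∑ i, fderiv ℝ (fderiv ℝ u) y (EuclideanSpace.single i 1)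
        (EuclideanSpace.single i 1) ≤ n * (4 / r) := by
      refine (Finset.sum_le_sum fun i _ => hyle (EuclideanSpace.single i 1)).trans ?_
      simp
    have h3 : fderiv ℝ (fderiv ℝ u) y (gradient u y) (gradient u y) ≤ 4 / r := by
      refine (hyle _).trans (mul_le_of_le_one_right (by positivity) ?_)
      exact pow_le_one₀ (norm_nonneg _) (hgrad y (hsub hy)).le
    have h4 := hV _ (hmem y hy)
    have h5 := hVge y hy
    have h6 := (abs_le.1 (hfb y hy)).1
    have h7 := mul_le_mul h4 h2 (Finset.sum_nonneg fun i _ => hpos y hy _) (by linarith)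
    have h8 := mul_le_mul (pow_le_pow_left₀ (by linarith) h4 3) h3 (hpos y hy _)
      (pow_nonneg (by linarith) 3)
    linarith
  refine bilin_le_of_trace_le _ (hpos x hx) (fun i j => (hH x (hsub hx)).hess_symm i j) ?_ v w
  have h1 := heq x hx
  rw [MinkDiv_eq (hdd x hx) (hgrad x (hsub hx))] at h1
  have h5 := hVge x hx
  have h6 := (abs_le.1 (hfb x hx)).2
  have h7 : 0 ≤ ∑ i, fderiv ℝ (fderiv ℝ u) x (EuclideanSpace.single i 1)
      (EuclideanSpace.single i 1) := Finset.sum_nonneg fun i _ => hpos x hx _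
  have h7_le := le_mul_of_one_le_left h7 h5
  have h8 := mul_nonneg (pow_nonneg (by linarith : 0 ≤ (Real.sqrt (1 - ‖gradient u x‖ ^ 2))⁻¹) 3)
    (hpos x hx (gradient u x))
  linarith

theorem statement_9 {n : ℕ} (hn : 2 ≤ n)
    (Ω Ωt : Set (Euc n)) (ht h : Euc n → ℝ) (θt θ : ℝ)
    (hdom : DomainSetup Ω Ωt ht h θt θ)
    (hball : closure Ωt ⊆ Metric.ball (0 : Euc n) 1)
    :
    ∀ K : ℝ, 0 < K →
      ∃ τ C₁ : ℝ, 0 < τ ∧ 0 < C₁ ∧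
        ∀ f : Euc n × Euc n → ℝ, InA Ω Ωt f → C2Bound Ω Ωt f K → OSCcond Ω Ωt f →
        ∀ (c : ℝ) (u : Euc n → ℝ), IsSmoothSol Ω Ωt f c u →
        ∀ x₀ ∈ frontier Ω,
          (∀ x ∈ frontier Ω,
              ⟪gradient h (gradient u x₀), gradient ht x₀⟫ + τ * h (gradient u x₀) ≤
                ⟪gradient h (gradient u x), gradient ht x⟫ + τ * h (gradient u x)) →
          -C₁ ≤ fderiv ℝ
              (fun x => ⟪gradient h (gradient u x), gradient ht x⟫ + τ * h (gradient u x))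
              x₀ (gradient ht x₀) := by
  intro K hK
  obtain ⟨hΩo, -, hΩb, hΩtb, ⟨z, hz⟩, ⟨p₀, hp₀⟩, hht, hh, hΩ, -, hνt, -, -, -, -, -⟩ := hdom
  have hn0 : 0 < n := by omega
  have hht2 : ContDiff ℝ 2 ht := hht.of_le (WithTop.coe_le_coe.2 (le_top : (2 : ℕ∞) ≤ ⊤))
  have hh2 : ContDiff ℝ 2 h := hh.of_le (WithTop.coe_le_coe.2 (le_top : (2 : ℕ∞) ≤ ⊤))
  have hGt := contDiff_gradient hht2
  have hG := contDiff_gradient hh2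
  have hcΩ : IsCompact (closure Ω) := hΩb.isCompact_closure
  have hcΩt : IsCompact (closure Ωt) := hΩtb.isCompact_closure
  obtain ⟨r, hr, hrball⟩ := Metric.nhds_basis_closedBall.mem_iff.1 (hΩo.mem_nhds hz)
  obtain ⟨V, hV⟩ : ∃ V, ∀ p ∈ closure Ωt, (Real.sqrt (1 - ‖p‖ ^ 2))⁻¹ ≤ V := by
    obtain ⟨V, hV⟩ := hcΩt.exists_bound_of_continuousOn
      (f := fun p => (Real.sqrt (1 - ‖p‖ ^ 2))⁻¹) <| by
        refine ContinuousOn.inv₀ (by fun_prop) fun p hp => ?_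
        have : ‖p‖ < 1 := by simpa using hball hp
        exact (Real.sqrt_pos.2 (by nlinarith [norm_nonneg p])).ne'
    exact ⟨V, fun p hp => (le_abs_self _).trans (hV p hp)⟩
  obtain ⟨M₁, hM₁⟩ := hcΩt.exists_bound_of_continuousOn hG.continuous.continuousOn
  obtain ⟨M₂, hM₂⟩ := hcΩt.exists_bound_of_continuousOn
    (hG.continuous_fderiv one_ne_zero).continuousOn
  obtain ⟨M₃, hM₃⟩ := hcΩ.exists_bound_of_continuousOn
    (hGt.continuous_fderiv one_ne_zero).continuousOn
  set T := (n : ℝ) ^ 2 * (V * (n * (4 / r)) + V ^ 3 * (4 / r) + 2 * K) with hT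
  have hp₀' : p₀ ∈ closure Ωt := subset_closure hp₀
  have hV0 : 0 ≤ V := (inv_nonneg.2 (Real.sqrt_nonneg _)).trans (hV p₀ hp₀')
  have hM₁0 : 0 ≤ M₁ := (norm_nonneg _).trans (hM₁ p₀ hp₀')
  have hM₂0 : 0 ≤ M₂ := (norm_nonneg _).trans (hM₂ p₀ hp₀')
  have hM₃0 : 0 ≤ M₃ := (norm_nonneg _).trans (hM₃ z (subset_closure hz))
  have hT0 : 0 ≤ T := by positivity
  refine ⟨1, M₁ * M₃ + M₂ * T + M₁ * T + 1, one_pos, by positivity, ?_⟩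
  intro f _ hf _ c u hu x₀ hx₀ _
  obtain ⟨δ, hδ, hH⟩ := hu.2.1
  have hx₀c : x₀ ∈ closure Ω := frontier_subset_closure hx₀
  have hdd : ∀ y ∈ closure Ω, DifferentiableAt ℝ (fderiv ℝ u) y := fun y hy =>
    differentiableAt_fderiv_of_hess hn0 hδ (hH y hy)
  have hg : ∀ y ∈ closure Ω, DifferentiableAt ℝ (gradient u) y := fun y hy =>
    (hasFDerivAt_gradient (hdd y hy)).differentiableAt
  have hν : ‖gradient ht x₀‖ = 1 := hνt x₀ hx₀
  have hp : gradient u x₀ ∈ closure Ωt := by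
    rw [← hu.2.2.2.2]
    exact ContinuousWithinAt.mem_closure_image
      (hg x₀ hx₀c).continuousAt.continuousWithinAt hx₀c
  have hin : ∀ᶠ t in 𝓝[>] (0 : ℝ), x₀ + t • gradient ht x₀ ∈ Ω := by
    have h0 : ht x₀ = 0 := eq_zero_of_mem_frontier_pos hht.continuous (hΩ ▸ hx₀)
    rw [hΩ]
    exact eventually_inward (hht2.differentiable two_ne_zero x₀) h0 hν
  set a := fderiv ℝ (gradient u) x₀ (gradient ht x₀) with ha
  have haT : ‖a‖ ≤ T := by
    refine norm_fderiv_le_of_inward (hg x₀ hx₀c) (fun y hy => hg y (subset_closure hy))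
      (fun y hy => ?_) hin
    rw [(hasFDerivAt_gradient (hdd y (subset_closure hy))).fderiv]
    set b := (dualToEuc n ∘L fderiv ℝ (fderiv ℝ u) y) (gradient ht x₀) with hb
    have h1 := hu.hess_le hn0 hΩo hr hrball hV hf hy (gradient ht x₀) b
    have h2 : fderiv ℝ (fderiv ℝ u) y (gradient ht x₀) b = ‖b‖ * ‖b‖ := by
      rw [← dualToEuc_inner, ← real_inner_self_eq_norm_mul_norm]
      rfl
    rw [h2, abs_mul_self, hν, one_mul, ← hT] at h1
    rcases (norm_nonneg b).eq_or_lt with h0 | h0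
    · rwa [← h0]
    · exact le_of_mul_le_mul_right h1 h0
  have hgd := (hg x₀ hx₀c).hasFDerivAt
  have hGd := (hG.differentiable one_ne_zero (gradient u x₀)).hasFDerivAt.comp x₀ hgd
  have hGtd := (hGt.differentiable one_ne_zero x₀).hasFDerivAt
  have hhd := (hh2.differentiable two_ne_zero (gradient u x₀)).hasFDerivAt.comp x₀ hgd
  have hω := (hGd.inner ℝ hGtd).add (hhd.const_mul 1)
  have hval := DFunLike.congr_fun hω.fderiv (gradient ht x₀)
  have hval' : fderiv ℝ (fun x => ⟪gradient h (gradient u x), gradient ht x⟫ +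
      1 * h (gradient u x)) x₀ (gradient ht x₀) =
      ⟪gradient h (gradient u x₀), fderiv ℝ (gradient ht) x₀ (gradient ht x₀)⟫ +
      ⟪fderiv ℝ (gradient h) (gradient u x₀) a, gradient ht x₀⟫ +
      ⟪gradient h (gradient u x₀), a⟫ := by
    refine hval.trans ?_
    rw [gradient_inner_right h _ a]
    simp [fderivInnerCLM_apply, ha]
  rw [hval']
  have e1 : |⟪gradient h (gradient u x₀), fderiv ℝ (gradient ht) x₀ (gradient ht x₀)⟫| ≤
      M₁ * M₃ := by
    refine (abs_real_inner_le_norm _ _).trans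
      (mul_le_mul (hM₁ _ hp) ?_ (norm_nonneg _) hM₁0)
    simpa [hν] using (fderiv ℝ (gradient ht) x₀).le_of_opNorm_le (hM₃ x₀ hx₀c) (gradient ht x₀)
  have e2 : |⟪fderiv ℝ (gradient h) (gradient u x₀) a, gradient ht x₀⟫| ≤ M₂ * T := by
    refine (abs_real_inner_le_norm _ _).trans ?_
    rw [hν, mul_one]
    exact (ContinuousLinearMap.le_of_opNorm_le _ (hM₂ _ hp) a).trans
      (mul_le_mul_of_nonneg_left haT hM₂0)
  have e3 : |⟪gradient h (gradient u x₀), a⟫| ≤ M₁ * T :=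
    (abs_real_inner_le_norm _ _).trans (mul_le_mul (hM₁ _ hp) haT (norm_nonneg _) hM₁0)
  have := (abs_le.1 e1).1
  have := (abs_le.1 e2).1
  have := (abs_le.1 e3).1
  linarith

end
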